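/- The number of Rota–Baxter operators of weight 1 on A = Fⁿ (direct sum of n copies of a field F with componentwise multiplication) equals 2ⁿ(n+1)^{n-1}. -/

import Mathlib

def IsRotaBaxter (F : Type*) {A : Type*} [Field F] [NonUnitalNonAssocRing A]
    [Module F A] (lam : F) (R : A →ₗ[F] A) : Prop :=
  ∀ x y : A, R x * R y = R (R x * y + x * R y + lam • (x * y))

/-- The incidence matrix, with the column of the root `none` removed, of the directed multigraph
on `Option (Fin n)` whose `i`-th edge goes from `(p i).1` to `(p i).2`. -/
def edgeMatrix (K : Type*) [CommRing K] {n : ℕ} (p : Fin n → Option (Fin n) × Option (Fin n)) :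
    Matrix (Fin n) (Fin n) K :=
  Matrix.of fun i k =>
    (if (p i).2 = some k then 1 else 0) - (if (p i).1 = some k then 1 else 0)

theorem edgeMatrix_map_intCast (K : Type*) [CommRing K] {n : ℕ}
    (p : Fin n → Option (Fin n) × Option (Fin n)) :
    (edgeMatrix ℤ p).map (Int.castRingHom K) = edgeMatrix K p := by
  ext i k
  simp [edgeMatrix, apply_ite (Int.cast : ℤ → K)]

theorem det_edgeMatrix_intCast (K : Type*) [CommRing K] {n : ℕ}
    (p : Fin n → Option (Fin n) × Option (Fin n)) :
    (edgeMatrix K p).det = ((edgeMatrix ℤ p).det : K) := by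
  rw [← edgeMatrix_map_intCast, ← RingHom.mapMatrix_apply, ← RingHom.map_det]
  rfl

theorem exists_edgeMatrix_submatrix {n : ℕ}
    (p : Fin (n + 1) → Option (Fin (n + 1)) × Option (Fin (n + 1))) (i k : Fin (n + 1)) :
    ∃ q, (edgeMatrix ℤ p).submatrix i.succAbove k.succAbove = edgeMatrix ℤ q := by
  have key : ∀ o : Option (Fin (n + 1)), ∃ o' : Option (Fin n),
      ∀ j, o = some (k.succAbove j) ↔ o' = some j := by
    rintro (_ | j)
    · exact ⟨none, by simp⟩
    · by_cases hj : j = k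
      · exact ⟨none, fun l => by simp [hj, (Fin.succAbove_ne k l).symm]⟩
      · obtain ⟨l, rfl⟩ := Fin.exists_succAbove_eq hj
        exact ⟨some l, fun m => by simp⟩
  choose c hc using key
  refine ⟨fun l => (c (p (i.succAbove l)).1, c (p (i.succAbove l)).2), ?_⟩
  ext l j
  simp [edgeMatrix, hc]

theorem det_edgeMatrix_int {n : ℕ} (p : Fin n → Option (Fin n) × Option (Fin n)) :
    (edgeMatrix ℤ p).det = 0 ∨ (edgeMatrix ℤ p).det = 1 ∨ (edgeMatrix ℤ p).det = -1 := by
  induction n with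
  | zero => simp
  | succ n ih =>
    by_cases h : ∃ i, (p i).1 = none ∨ (p i).2 = none
    · obtain ⟨i, hi⟩ := h
      obtain ⟨k, c, hc, hrow⟩ : ∃ (k : Fin (n + 1)) (c : ℤ), (c = 0 ∨ c = 1 ∨ c = -1) ∧
          ∀ j, edgeMatrix ℤ p i j = if j = k then c else 0 := by
        rcases hp : p i with ⟨_ | a, _ | b⟩
        · exact ⟨0, 0, by simp, by simp [edgeMatrix, hp]⟩
        · exact ⟨b, 1, by simp, by simp [edgeMatrix, hp, eq_comm]⟩
        · exact ⟨a, -1, by simp, fun j => by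
            by_cases hj : a = j <;> simp [edgeMatrix, hp, hj, eq_comm]⟩
        · simp [hp] at hi
      obtain ⟨q, hq⟩ := exists_edgeMatrix_submatrix p i k
      have hdet : (edgeMatrix ℤ p).det =
          (-1) ^ ((i : ℕ) + k) * c * (edgeMatrix ℤ q).det := by
        rw [Matrix.det_succ_row _ i, Finset.sum_eq_single k]
        · rw [hq, hrow, if_pos rfl]
        · intro j _ hj
          simp [hrow, hj]
        · simp
      rw [hdet]
      rcases neg_one_pow_eq_or ℤ ((i : ℕ) + k) with hs | hs <;>
        rcases hc with rfl | rfl | rfl <;> rcases ih q with hd | hd | hd <;> simp [hs, hd]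
    · push Not at h
      left
      refine Matrix.exists_mulVec_eq_zero_iff.mp ⟨fun _ => 1, fun h0 => ?_, ?_⟩
      · simpa using congrFun h0 0
      · ext i
        obtain ⟨a, ha⟩ := Option.ne_none_iff_exists'.mp (h i).1
        obtain ⟨b, hb⟩ := Option.ne_none_iff_exists'.mp (h i).2
        simp [edgeMatrix, Matrix.mulVec, dotProduct, ha, hb]

theorem det_edgeMatrix_sq (F : Type*) [Field F] {n : ℕ}
    [DecidablePred fun p : Fin n → Option (Fin n) × Option (Fin n) => (edgeMatrix F p).det ≠ 0]
    (p : Fin n → Option (Fin n) × Option (Fin n)) :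
    (edgeMatrix ℚ p).det ^ 2 = if (edgeMatrix F p).det ≠ 0 then 1 else 0 := by
  rw [det_edgeMatrix_intCast ℚ]
  split_ifs with h <;> rw [det_edgeMatrix_intCast F] at h <;>
    rcases det_edgeMatrix_int p with hd | hd | hd <;> simp_all

/-- A Cauchy–Binet formula: the sum of the squared determinants of all matrices with rows in the
family `v`. -/
theorem sum_det_sq {ι κ K : Type*} [Fintype ι] [DecidableEq ι] [Fintype κ] [CommRing K]
    (v : κ → ι → K) :
    ∑ p : ι → κ, (Matrix.of fun i => v (p i)).det ^ 2 =
      (Fintype.card ι).factorial * (Matrix.of fun j k => ∑ e, v e j * v e k).det := by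
  have hterm : ∀ p : ι → κ, (Matrix.of fun i => v (p i)).det ^ 2 =
      ∑ σ : Equiv.Perm ι, ∑ τ : Equiv.Perm ι,
        ((σ.sign : ℤ) : K) * ((τ.sign : ℤ) : K) * ∏ i, (v (p i) (σ i) * v (p i) (τ i)) := by
    intro p
    rw [← Matrix.det_transpose, Matrix.det_apply', sq, Finset.sum_mul_sum]
    refine Finset.sum_congr rfl fun σ _ => Finset.sum_congr rfl fun τ _ => ?_
    simp only [Matrix.transpose_apply, Matrix.of_apply, Finset.prod_mul_distrib]
    ring
  simp_rw [hterm]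
  rw [Finset.sum_comm]
  have hperm : ∀ σ : Equiv.Perm ι, ∑ p : ι → κ, ∑ τ : Equiv.Perm ι,
        ((σ.sign : ℤ) : K) * ((τ.sign : ℤ) : K) * ∏ i, (v (p i) (σ i) * v (p i) (τ i)) =
      (Matrix.of fun j k => ∑ e, v e j * v e k).det := by
    intro σ
    rw [Finset.sum_comm]
    have hsum : ∀ τ : Equiv.Perm ι, ∑ p : ι → κ,
          ((σ.sign : ℤ) : K) * ((τ.sign : ℤ) : K) * ∏ i, (v (p i) (σ i) * v (p i) (τ i)) =
        ((σ.sign : ℤ) : K) * (((τ.sign : ℤ) : K) *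
          ∏ i, (Matrix.of fun j k => ∑ e, v e j * v e k) (σ i) (τ i)) := by
      intro τ
      rw [← Finset.mul_sum, mul_assoc]
      simp only [Matrix.of_apply]
      rw [Fintype.prod_sum]
    simp_rw [hsum]
    rw [← Finset.mul_sum, ← Matrix.det_transpose, Matrix.det_apply', Finset.mul_sum]
    refine Fintype.sum_equiv (Equiv.mulRight σ⁻¹) _ _ fun τ => ?_
    rw [← mul_assoc]
    congr 1
    · simp [mul_comm]
    · rw [← Equiv.prod_comp σ (fun i => (Matrix.of fun j k => ∑ e, v e j * v e k).transpose
        ((Equiv.mulRight σ⁻¹ τ) i) i)]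
      simp
  simp [hperm, Fintype.card_perm]

theorem sum_edge_vector_mul {n : ℕ} (j k : Fin n) :
    ∑ e : Option (Fin n) × Option (Fin n),
      ((if e.2 = some j then 1 else 0) - (if e.1 = some j then 1 else 0) : ℚ) *
        ((if e.2 = some k then 1 else 0) - (if e.1 = some k then 1 else 0)) =
      2 * (n + 1) * (if j = k then 1 else 0) - 2 := by
  rw [Fintype.sum_prod_type]
  by_cases h : j = k
  · subst h
    simp [mul_sub, Finset.sum_sub_distrib]
    ring
  · simp [mul_sub, Finset.sum_sub_distrib, h, Ne.symm h]
    norm_num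

theorem det_edge_gram {n : ℕ} (hn : 0 < n) :
    (Matrix.of fun j k : Fin n => (2 * (n + 1) * (if j = k then 1 else 0) - 2 : ℚ)).det =
      2 ^ n * (n + 1) ^ (n - 1) := by
  have h0 : (n + 1 : ℚ) ≠ 0 := by positivity
  have : (Matrix.of fun j k : Fin n => (2 * (n + 1) * (if j = k then 1 else 0) - 2 : ℚ)) =
      (2 * (n + 1) : ℚ) • (1 + Matrix.replicateCol Unit (fun _ : Fin n => -(n + 1 : ℚ)⁻¹) *
        Matrix.replicateRow Unit (fun _ : Fin n => (1 : ℚ))) := by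
    ext j k
    simp [Matrix.mul_apply, Matrix.one_apply]
    split_ifs <;> field_simp <;> ring
  rw [this, Matrix.det_smul, Matrix.det_one_add_replicateCol_mul_replicateRow]
  obtain ⟨m, rfl⟩ := Nat.exists_eq_succ_of_ne_zero hn.ne'
  simp [dotProduct, mul_pow, pow_succ]
  field_simp
  ring

theorem card_edgeMatrix_det_ne_zero (F : Type*) [Field F] {n : ℕ} (hn : 0 < n) :
    Nat.card {p : Fin n → Option (Fin n) × Option (Fin n) // (edgeMatrix F p).det ≠ 0} =
      n.factorial * (2 ^ n * (n + 1) ^ (n - 1)) := by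
  classical
  have h := sum_det_sq (ι := Fin n) (K := ℚ) fun (e : Option (Fin n) × Option (Fin n)) k =>
    (if e.2 = some k then 1 else 0) - (if e.1 = some k then 1 else 0)
  simp_rw [sum_edge_vector_mul] at h
  rw [det_edge_gram hn, Fintype.card_fin] at h
  have h' : ∑ p, (edgeMatrix ℚ p).det ^ 2 =
      (n.factorial : ℚ) * (2 ^ n * (n + 1) ^ (n - 1)) := h
  simp_rw [det_edgeMatrix_sq F, Finset.sum_boole] at h'
  rw [Nat.card_eq_fintype_card, Fintype.card_subtype]
  exact_mod_cast h'

theorem edgeMatrix_mulVec {F : Type*} [Field F] {n : ℕ}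
    (p : Fin n → Option (Fin n) × Option (Fin n)) (f : Fin n → F) (i : Fin n) :
    (edgeMatrix F p).mulVec f i = (p i).2.elim 0 f - (p i).1.elim 0 f := by
  rcases hp : p i with ⟨_ | a, _ | b⟩ <;>
    simp [edgeMatrix, Matrix.mulVec, dotProduct, hp, sub_mul]

/-- The operator sending `x` to the values, at the sources of the edges, of the function on the
vertices which vanishes at the root and has differences `x` along the edges. -/
noncomputable def edgeOperator (F : Type*) [Field F] {n : ℕ}
    (p : Fin n → Option (Fin n) × Option (Fin n)) : (Fin n → F) →ₗ[F] (Fin n → F) :=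
  LinearMap.pi fun i => (p i).1.elim 0 fun k =>
    LinearMap.proj k ∘ₗ (edgeMatrix F p)⁻¹.mulVecLin

theorem edgeOperator_apply {F : Type*} [Field F] {n : ℕ}
    (p : Fin n → Option (Fin n) × Option (Fin n)) (x : Fin n → F) (i : Fin n) :
    edgeOperator F p x i = (p i).1.elim 0 ((edgeMatrix F p)⁻¹.mulVec x) := by
  rcases hp : (p i).1 with _ | a <;> simp [edgeOperator, hp]

theorem edgeOperator_apply_add {F : Type*} [Field F] {n : ℕ}
    {p : Fin n → Option (Fin n) × Option (Fin n)} (hp : (edgeMatrix F p).det ≠ 0)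
    (x : Fin n → F) (i : Fin n) :
    edgeOperator F p x i + x i = (p i).2.elim 0 ((edgeMatrix F p)⁻¹.mulVec x) := by
  have h : (edgeMatrix F p).mulVec ((edgeMatrix F p)⁻¹.mulVec x) i = x i := by
    rw [Matrix.mulVec_mulVec, Matrix.mul_nonsing_inv _ (isUnit_iff_ne_zero.mpr hp),
      Matrix.one_mulVec]
  rw [edgeMatrix_mulVec] at h
  rw [edgeOperator_apply, ← h]
  ring

theorem isRotaBaxter_edgeOperator {F : Type*} [Field F] {n : ℕ}
    {p : Fin n → Option (Fin n) × Option (Fin n)} (hp : (edgeMatrix F p).det ≠ 0) :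
    IsRotaBaxter F 1 (edgeOperator F p) := by
  intro x y
  have hmul : ∀ (o : Option (Fin n)) (f g : Fin n → F),
      o.elim 0 (f * g) = o.elim 0 f * o.elim 0 g := by
    rintro (_ | a) f g <;> simp
  have hinv : ∀ f, (edgeMatrix F p)⁻¹.mulVec ((edgeMatrix F p).mulVec f) = f := by
    intro f
    rw [Matrix.mulVec_mulVec, Matrix.nonsing_inv_mul _ (isUnit_iff_ne_zero.mpr hp),
      Matrix.one_mulVec]
  have key : edgeOperator F p x * y + x * edgeOperator F p y + (1 : F) • (x * y) =
      (edgeMatrix F p).mulVec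
        ((edgeMatrix F p)⁻¹.mulVec x * (edgeMatrix F p)⁻¹.mulVec y) := by
    ext i
    rw [edgeMatrix_mulVec, hmul, hmul, ← edgeOperator_apply, ← edgeOperator_apply,
      ← edgeOperator_apply_add hp, ← edgeOperator_apply_add hp]
    simp
    ring
  ext i
  rw [key, edgeOperator_apply, hinv, hmul, Pi.mul_apply, edgeOperator_apply, edgeOperator_apply]

/-- Distinct nonzero multiplicative functionals are linearly independent; the multiplication `μ`
may be arbitrary. -/
theorem linearIndependent_of_multiplicative {F V ι : Type*} [Field F] [AddCommGroup V] [Module F V]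
    (μ : V → V → V) (s : ι → V →ₗ[F] F) (hs : Function.Injective s) (hs0 : ∀ i, s i ≠ 0)
    (hmul : ∀ i x y, s i (μ x y) = s i x * s i y) : LinearIndependent F s := by
  classical
  rw [linearIndependent_iff']
  intro T
  induction T using Finset.induction_on with
  | empty => simp
  | insert t T ht ih =>
    intro c hc
    have hrel : ∀ z, c t * s t z + ∑ i ∈ T, c i * s i z = 0 := by
      intro z
      simpa [Finset.sum_insert ht] using congrArg (fun f : V →ₗ[F] F => f z) hc
    have hT : ∀ i ∈ T, c i = 0 := by
      intro i hi
      have hst : s i ≠ s t := fun h => ht (hs h ▸ hi)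
      obtain ⟨x, hx⟩ : ∃ x, s i x ≠ s t x := by
        by_contra! hx
        exact hst (LinearMap.ext hx)
      have hzero : c i * (s i x - s t x) = 0 := by
        refine ih (fun j => c j * (s j x - s t x)) (LinearMap.ext fun y => ?_) i hi
        have h1 := hrel (μ x y)
        have h2 := hrel y
        simp only [hmul] at h1
        have h3 : ∑ j ∈ T, c j * (s j x - s t x) * s j y =
            ∑ j ∈ T, c j * (s j x * s j y) - s t x * ∑ j ∈ T, c j * s j y := by
          rw [Finset.mul_sum, ← Finset.sum_sub_distrib]
          exact Finset.sum_congr rfl fun j _ => by ring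
        simp only [LinearMap.coe_sum, Finset.sum_apply, LinearMap.smul_apply, smul_eq_mul,
          LinearMap.zero_apply, h3]
        linear_combination h1 - s t x * h2
      exact (mul_eq_zero.mp hzero).resolve_right (sub_ne_zero.mpr hx)
    refine (Finset.forall_mem_insert _ _ _).mpr ⟨?_, hT⟩
    by_contra hct
    refine hs0 t (LinearMap.ext fun z => ?_)
    have h := hrel z
    rw [Finset.sum_eq_zero fun i hi => by rw [hT i hi, zero_mul], add_zero] at h
    exact (mul_eq_zero.mp h).resolve_left hct

/-- The nonzero functionals among the coordinates of `R` and of `R + id`. -/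
def rotaBaxterCharacters {F : Type*} [Field F] {n : ℕ} (R : (Fin n → F) →ₗ[F] (Fin n → F)) :
    Set ((Fin n → F) →ₗ[F] F) :=
  {s | s ≠ 0 ∧ ∃ i, s = LinearMap.proj i ∘ₗ R ∨ s = LinearMap.proj i ∘ₗ (R + LinearMap.id)}

theorem finite_rotaBaxterCharacters {F : Type*} [Field F] {n : ℕ}
    (R : (Fin n → F) →ₗ[F] (Fin n → F)) : (rotaBaxterCharacters R).Finite := by
  refine ((Set.finite_range fun i => LinearMap.proj i ∘ₗ R).union
    (Set.finite_range fun i => LinearMap.proj i ∘ₗ (R + LinearMap.id))).subset ?_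
  rintro s ⟨-, i, rfl | rfl⟩
  · exact Or.inl ⟨i, rfl⟩
  · exact Or.inr ⟨i, rfl⟩

theorem card_rotaBaxterCharacters {F : Type*} [Field F] {n : ℕ}
    {R : (Fin n → F) →ₗ[F] (Fin n → F)} (hR : IsRotaBaxter F 1 R) :
    Nat.card (rotaBaxterCharacters R) = n := by
  have := (finite_rotaBaxterCharacters R).fintype
  have hli : LinearIndependent F
      (fun s : rotaBaxterCharacters R => (s : (Fin n → F) →ₗ[F] F)) := by
    refine linearIndependent_of_multiplicative
      (fun x y => R x * y + x * R y + (1 : F) • (x * y)) _ Subtype.val_injective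
      (fun s => s.2.1) ?_
    rintro ⟨s, -, i, rfl | rfl⟩ x y
    · exact (congrFun (hR x y) i).symm
    · have h := congrFun (hR x y) i
      rw [LinearMap.comp_apply, LinearMap.add_apply, map_add, LinearMap.proj_apply, ← h]
      simp
      ring
  have hspan : Submodule.span F
      (Set.range fun s : rotaBaxterCharacters R => (s : (Fin n → F) →ₗ[F] F)) = ⊤ := by
    rw [Subtype.range_coe]
    have hmem : ∀ s : (Fin n → F) →ₗ[F] F, (∃ i, s = LinearMap.proj i ∘ₗ R ∨
        s = LinearMap.proj i ∘ₗ (R + LinearMap.id)) →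
        s ∈ Submodule.span F (rotaBaxterCharacters R) := by
      intro s hs
      by_cases h0 : s = 0
      · rw [h0]
        exact Submodule.zero_mem _
      · exact Submodule.subset_span ⟨h0, hs⟩
    refine eq_top_iff.mpr fun φ _ => ?_
    have hφ : φ = ∑ i, φ (Pi.single i 1) •
        (LinearMap.proj i ∘ₗ (R + LinearMap.id) - LinearMap.proj i ∘ₗ R) := by
      refine LinearMap.pi_ext' fun i => LinearMap.ext_ring ?_
      simp [Pi.single_apply]
    rw [hφ]
    exact Submodule.sum_mem _ fun i _ => Submodule.smul_mem _ _
      (Submodule.sub_mem _ (hmem _ ⟨i, Or.inr rfl⟩) (hmem _ ⟨i, Or.inl rfl⟩))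
  have hcard := finrank_span_eq_card hli
  rw [hspan, finrank_top] at hcard
  rw [Nat.card_eq_fintype_card, ← hcard]
  exact (Subspace.dual_finrank_eq (K := F) (V := Fin n → F)).trans (by simp)

/-- The values at the non-root vertices of the function underlying `edgeOperator F p`. -/
noncomputable def vertexFunctional (F : Type*) [Field F] {n : ℕ}
    (p : Fin n → Option (Fin n) × Option (Fin n)) (k : Fin n) : (Fin n → F) →ₗ[F] F :=
  LinearMap.proj k ∘ₗ (edgeMatrix F p)⁻¹.mulVecLin

theorem proj_comp_edgeOperator {F : Type*} [Field F] {n : ℕ}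
    (p : Fin n → Option (Fin n) × Option (Fin n)) (i : Fin n) :
    LinearMap.proj i ∘ₗ edgeOperator F p = (p i).1.elim 0 (vertexFunctional F p) := by
  rfl

theorem proj_comp_edgeOperator_add_id {F : Type*} [Field F] {n : ℕ}
    {p : Fin n → Option (Fin n) × Option (Fin n)} (hp : (edgeMatrix F p).det ≠ 0) (i : Fin n) :
    LinearMap.proj i ∘ₗ (edgeOperator F p + LinearMap.id) =
      (p i).2.elim 0 (vertexFunctional F p) := by
  refine LinearMap.ext fun x => ?_
  have h := edgeOperator_apply_add hp x i
  rcases hi : (p i).2 with _ | b <;> simpa [hi, vertexFunctional] using h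

theorem elim_vertexFunctional_injective {F : Type*} [Field F] {n : ℕ}
    {p : Fin n → Option (Fin n) × Option (Fin n)} (hp : (edgeMatrix F p).det ≠ 0) :
    Function.Injective fun o : Option (Fin n) => o.elim 0 (vertexFunctional F p) := by
  have hv : ∀ k l, vertexFunctional F p k ((edgeMatrix F p).col l) =
      if k = l then 1 else 0 := by
    intro k l
    rw [← Matrix.mulVec_single_one, vertexFunctional, LinearMap.comp_apply, Matrix.mulVecLin_apply,
      Matrix.mulVec_mulVec, Matrix.nonsing_inv_mul _ (isUnit_iff_ne_zero.mpr hp),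
      Matrix.one_mulVec]
    simp [Pi.single_apply]
  rintro (_ | k) (_ | l) h
  · rfl
  · simpa [hv] using congrArg
      (fun f : (Fin n → F) →ₗ[F] F => f ((edgeMatrix F p).col l)) h
  · simpa [hv] using congrArg
      (fun f : (Fin n → F) →ₗ[F] F => f ((edgeMatrix F p).col k)) h
  · simpa [hv] using congrArg
      (fun f : (Fin n → F) →ₗ[F] F => f ((edgeMatrix F p).col l)) h

theorem vertexFunctional_bijOn {F : Type*} [Field F] {n : ℕ}
    {p : Fin n → Option (Fin n) × Option (Fin n)} (hp : (edgeMatrix F p).det ≠ 0) :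
    Set.BijOn (vertexFunctional F p) Set.univ (rotaBaxterCharacters (edgeOperator F p)) := by
  have hinj := elim_vertexFunctional_injective hp
  refine ⟨fun k _ => ⟨fun h => ?_, ?_⟩, fun k _ l _ h => ?_, ?_⟩
  · simpa using @hinj (some k) none h
  · have hk : ∃ i, (p i).1 = some k ∨ (p i).2 = some k := by
      by_contra! hk
      exact hp (Matrix.det_eq_zero_of_column_eq_zero k fun i => by
        simp [edgeMatrix, (hk i).1, (hk i).2])
    obtain ⟨i, hi⟩ := hk
    refine ⟨i, ?_⟩
    rw [proj_comp_edgeOperator, proj_comp_edgeOperator_add_id hp]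
    rcases hi with hi | hi <;> simp [hi]
  · simpa using @hinj (some k) (some l) h
  · rintro s ⟨hs, i, hi⟩
    rw [proj_comp_edgeOperator, proj_comp_edgeOperator_add_id hp] at hi
    rcases hi with hi | hi
    · rcases ho : (p i).1 with _ | k <;> simp only [ho, Option.elim] at hi
      exacts [absurd hi hs, ⟨k, trivial, hi.symm⟩]
    · rcases ho : (p i).2 with _ | k <;> simp only [ho, Option.elim] at hi
      exacts [absurd hi hs, ⟨k, trivial, hi.symm⟩]

theorem eq_of_vertexFunctional_eq {F : Type*} [Field F] {n : ℕ}
    {p q : Fin n → Option (Fin n) × Option (Fin n)} (hp : (edgeMatrix F p).det ≠ 0)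
    (hq : (edgeMatrix F q).det ≠ 0) (hR : edgeOperator F p = edgeOperator F q)
    (hv : vertexFunctional F p = vertexFunctional F q) : p = q := by
  funext i
  have hinj := elim_vertexFunctional_injective hq
  refine Prod.ext (hinj ?_) (hinj ?_)
  · have h := proj_comp_edgeOperator (F := F) p i
    rwa [hR, proj_comp_edgeOperator, hv, eq_comm] at h
  · have h := proj_comp_edgeOperator_add_id hp i
    rwa [hR, proj_comp_edgeOperator_add_id hq, hv, eq_comm] at h

theorem exists_edgeOperator_eq {F : Type*} [Field F] {n : ℕ}
    (R : (Fin n → F) →ₗ[F] (Fin n → F)) (e : Fin n ≃ rotaBaxterCharacters R) :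
    ∃ p, (edgeMatrix F p).det ≠ 0 ∧ edgeOperator F p = R ∧
      ∀ k, vertexFunctional F p k = e k := by
  have hex : ∀ s : (Fin n → F) →ₗ[F] F, (∃ i, s = LinearMap.proj i ∘ₗ R ∨
      s = LinearMap.proj i ∘ₗ (R + LinearMap.id)) →
      ∃ o : Option (Fin n), s = o.elim 0 fun k => (e k : (Fin n → F) →ₗ[F] F) := by
    intro s hs
    by_cases h0 : s = 0
    · exact ⟨none, h0⟩
    · exact ⟨some (e.symm ⟨s, h0, hs⟩), by simp⟩
  choose a ha using fun i => hex (LinearMap.proj i ∘ₗ R) ⟨i, Or.inl rfl⟩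
  choose b hb using fun i => hex (LinearMap.proj i ∘ₗ (R + LinearMap.id)) ⟨i, Or.inr rfl⟩
  have hev : ∀ (o : Option (Fin n)) (x : Fin n → F),
      (o.elim 0 fun k => (e k : (Fin n → F) →ₗ[F] F)) x =
        o.elim 0 fun k => (e k : (Fin n → F) →ₗ[F] F) x := by
    rintro (_ | k) x <;> rfl
  have hmulVec : ∀ x, (edgeMatrix F fun i => (a i, b i)).mulVec (fun k => (e k).1 x) = x := by
    intro x
    ext i
    rw [edgeMatrix_mulVec, ← hev, ← hev, ← ha, ← hb]
    simp
  have hmul : (edgeMatrix F fun i => (a i, b i)) *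
      LinearMap.toMatrix' (LinearMap.pi fun k => (e k).1) = 1 := by
    refine Matrix.ext_of_mulVec_single fun i => ?_
    rw [← Matrix.mulVec_mulVec, LinearMap.toMatrix'_mulVec, Matrix.one_mulVec]
    exact hmulVec _
  have hinv := Matrix.inv_eq_right_inv hmul
  have hv : ∀ k, vertexFunctional F (fun i => (a i, b i)) k = e k := by
    intro k
    refine LinearMap.ext fun x => ?_
    rw [vertexFunctional, hinv, LinearMap.comp_apply, Matrix.mulVecLin_apply,
      LinearMap.toMatrix'_mulVec]
    rfl
  refine ⟨fun i => (a i, b i), (Matrix.isUnit_det_of_right_inverse hmul).ne_zero, ?_, hv⟩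
  refine LinearMap.ext fun x => funext fun i => ?_
  have hi := congrArg (fun g : (Fin n → F) →ₗ[F] F => g x)
    (proj_comp_edgeOperator (F := F) (fun i => (a i, b i)) i)
  rw [funext hv, ← ha] at hi
  exact hi

theorem card_edgeOperator_fiber {F : Type*} [Field F] {n : ℕ}
    {R : (Fin n → F) →ₗ[F] (Fin n → F)} (hR : IsRotaBaxter F 1 R) :
    Nat.card {p : {p : Fin n → Option (Fin n) × Option (Fin n) // (edgeMatrix F p).det ≠ 0} //
      edgeOperator F p.1 = R} = n.factorial := by
  classical
  have := (finite_rotaBaxterCharacters R).fintype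
  have hcard : Fintype.card (rotaBaxterCharacters R) = n := by
    rw [← Nat.card_eq_fintype_card, card_rotaBaxterCharacters hR]
  have hbij : ∀ p : {p : {p : Fin n → Option (Fin n) × Option (Fin n) //
      (edgeMatrix F p).det ≠ 0} // edgeOperator F p.1 = R},
      ∃ e : Fin n ≃ rotaBaxterCharacters R, ∀ k, (e k).1 = vertexFunctional F p.1.1 k := by
    rintro ⟨⟨p, hp⟩, rfl⟩
    exact ⟨(Equiv.Set.univ _).symm.trans (vertexFunctional_bijOn hp).equiv, fun k => rfl⟩
  choose E hE using hbij
  have hEbij : Function.Bijective E := by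
    constructor
    · rintro ⟨⟨p, hp⟩, hpR⟩ ⟨⟨q, hq⟩, hqR⟩ h
      have hpq : p = q := eq_of_vertexFunctional_eq hp hq (hpR.trans hqR.symm) <| by
        funext k
        rw [← hE ⟨⟨p, hp⟩, hpR⟩ k, h, hE]
      subst hpq
      rfl
    · intro e
      obtain ⟨p, hp, hpR, hv⟩ := exists_edgeOperator_eq R e
      refine ⟨⟨⟨p, hp⟩, hpR⟩, Equiv.ext fun k => Subtype.ext ?_⟩
      rw [hE, hv]
  rw [Nat.card_congr (Equiv.ofBijective E hEbij), Nat.card_eq_fintype_card,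
    Fintype.card_equiv (Fintype.equivOfCardEq (by rw [hcard, Fintype.card_fin])),
    Fintype.card_fin]

theorem stmt14 (F : Type*) [Field F] (h2 : (2 : F) ≠ 0) (n : ℕ) (hn : 0 < n) :
    {R : (Fin n → F) →ₗ[F] (Fin n → F) | IsRotaBaxter F 1 R}.ncard =
      2 ^ n * (n + 1) ^ (n - 1) := by
  let f : {p : Fin n → Option (Fin n) × Option (Fin n) // (edgeMatrix F p).det ≠ 0} →
      {R : (Fin n → F) →ₗ[F] (Fin n → F) | IsRotaBaxter F 1 R} :=
    fun p => ⟨edgeOperator F p.1, isRotaBaxter_edgeOperator p.2⟩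
  have hfiber : ∀ R, Nat.card {p // f p = R} = n.factorial := by
    intro R
    rw [← card_edgeOperator_fiber R.2]
    exact Nat.card_congr (Equiv.subtypeEquivRight fun p => Subtype.ext_iff)
  have hsurj : Function.Surjective f := by
    intro R
    by_contra hR
    have := hfiber R
    have : IsEmpty {p // f p = R} := ⟨fun p => hR ⟨p.1, p.2⟩⟩
    simp_all [Nat.factorial_ne_zero, eq_comm]
  have := Finite.of_surjective f hsurj
  have := Fintype.ofFinite {R : (Fin n → F) →ₗ[F] (Fin n → F) | IsRotaBaxter F 1 R}
  have hcard := Nat.card_congr (Equiv.sigmaFiberEquiv f)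
  rw [Nat.card_sigma, card_edgeMatrix_det_ne_zero F hn] at hcard
  simp only [hfiber, Finset.sum_const, Finset.card_univ, smul_eq_mul] at hcard
  rw [← Nat.card_eq_fintype_card, mul_comm] at hcard
  exact Nat.eq_of_mul_eq_mul_left n.factorial_pos hcard
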